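/- Let X be a rearrangement invariant quasi-Banach space on ℝ, let 0 < p < ∞ and 0 < r < ∞, and suppose ‖H^{(p,r)} f‖_X ≤ C ‖f‖_X for all f ∈ X. Then for every integer n ≥ 0, every 0 < a < 1, and every f ∈ X: ‖D_a f‖_X ≤ C^{n+1} ( n! / ( a^{r/p} ((r/p) log(1/a))^n ) )^{1/r} ‖f‖_X. -/

import Mathlib

open MeasureTheory Set Filter Topology ENNReal

noncomputable section

/-- The decreasing rearrangement of an `ℝ≥0∞`-valued function with respect to a measure `μ`:
`g⁎(s) = sup {t : μ {x | g x > t} > s}`. -/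
def distRearr {α : Type*} [MeasurableSpace α] (μ : Measure α) (g : α → ℝ≥0∞) (s : ℝ) : ℝ≥0∞ :=
  sSup {t : ℝ≥0∞ | ENNReal.ofReal s < μ {x | t < g x}}

/-- Decreasing rearrangement of an `ℝ≥0∞`-valued function on `ℝ` (Lebesgue measure). -/
def rearrE (g : ℝ → ℝ≥0∞) : ℝ → ℝ≥0∞ := distRearr (volume : Measure ℝ) g

/-- Decreasing rearrangement `f^*` of a real-valued function on `ℝ`:
`f^*(s) = sup {t ≥ 0 : volume {x : |f x| > t} > s}`. -/
def rearr (f : ℝ → ℝ) : ℝ → ℝ≥0∞ := rearrE fun x => ENNReal.ofReal |f x|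

/-- The dilation operator `D_a f (t) = f (a t)`. -/
def dil (a : ℝ) (f : ℝ → ℝ) : ℝ → ℝ := fun t => f (a * t)

/-- The dilation operator on `ℝ≥0∞`-valued functions. -/
def dilE (a : ℝ) (g : ℝ → ℝ≥0∞) : ℝ → ℝ≥0∞ := fun t => g (a * t)

/-- A rearrangement invariant quasi-Banach function space on `ℝ` (with Lebesgue measure).
The quasi-norm `N` is defined on all `ℝ≥0∞`-valued functions (a signed function `f`
is measured via `|f|`, embedded into `ℝ≥0∞`; this is harmless since the quasi-norm of a
rearrangement invariant space depends only on `|f|`).  Membership of a signed function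
`f` in the space means `f` is measurable with `N (|f|) < ∞`. -/
structure RIQB where
  /-- the quasi-norm -/
  N : (ℝ → ℝ≥0∞) → ℝ≥0∞
  /-- the quasi-triangle inequality constant -/
  C : ℝ
  one_le_C : 1 ≤ C
  /-- homogeneity of the quasi-norm -/
  norm_smul : ∀ (c : ℝ≥0∞) (g : ℝ → ℝ≥0∞), N (fun x => c * g x) = c * N g
  /-- the quasi-triangle inequality -/
  quasi_triangle : ∀ g h : ℝ → ℝ≥0∞, AEMeasurable g volume → AEMeasurable h volume →
    N (fun x => g x + h x) ≤ ENNReal.ofReal C * (N g + N h)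
  /-- definiteness (functions are identified a.e.) -/
  definite : ∀ g : ℝ → ℝ≥0∞, AEMeasurable g volume → (N g = 0 ↔ g =ᵐ[volume] 0)
  /-- property (i): if `h^* ≤ g^*` then `‖h‖ ≤ ‖g‖` -/
  rearr_mono : ∀ g h : ℝ → ℝ≥0∞, AEMeasurable g volume → AEMeasurable h volume →
    (∀ s : ℝ, 0 < s → rearrE h s ≤ rearrE g s) → N h ≤ N g
  /-- property (ii): simple functions with support of finite measure belong to the space -/
  simple_mem : ∀ f : MeasureTheory.SimpleFunc ℝ ℝ,
    volume (Function.support (f : ℝ → ℝ)) < ∞ → N (fun x => ENNReal.ofReal |f x|) < ∞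
  /-- property (iii) or (iii′) -/
  fatou :
    (∀ g : ℕ → ℝ → ℝ≥0∞, (∀ n, AEMeasurable (g n) volume ∧ N (g n) < ∞) →
      (∀ x, Antitone fun n => g n x) → (∀ x, Tendsto (fun n => g n x) atTop (𝓝 0)) →
      Tendsto (fun n => N (g n)) atTop (𝓝 0)) ∨
    (∀ (g : ℕ → ℝ → ℝ≥0∞) (h : ℝ → ℝ≥0∞),
      (∀ n, AEMeasurable (g n) volume ∧ N (g n) < ∞) →
      (∀ x, Monotone fun n => g n x) → (∀ x, Tendsto (fun n => g n x) atTop (𝓝 (h x))) →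
      (⨆ n, N (g n)) < ∞ → N h = ⨆ n, N (g n))
  /-- completeness of the quasi-norm -/
  complete : ∀ f : ℕ → ℝ → ℝ,
    (∀ n, AEMeasurable (f n) volume ∧ N (fun x => ENNReal.ofReal |f n x|) < ∞) →
    (∀ ε : ℝ, 0 < ε → ∃ M : ℕ, ∀ m ≥ M, ∀ n ≥ M,
      N (fun x => ENNReal.ofReal |f m x - f n x|) < ENNReal.ofReal ε) →
    ∃ g : ℝ → ℝ, AEMeasurable g volume ∧ N (fun x => ENNReal.ofReal |g x|) < ∞ ∧
      Tendsto (fun n => N (fun x => ENNReal.ofReal |f n x - g x|)) atTop (𝓝 0)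

/-- The quasi-norm of a signed function. -/
def RIQB.Nr (X : RIQB) (f : ℝ → ℝ) : ℝ≥0∞ := X.N fun x => ENNReal.ofReal |f x|

/-- Membership in the space. -/
def RIQB.mem (X : RIQB) (f : ℝ → ℝ) : Prop := AEMeasurable f volume ∧ X.Nr f < ∞

/-- The lower Boyd index of a quasi-norm functional:
`sup {p > 0 : ∃ c > 0, ∀ 0 < a < 1, ∀ f ∈ X, ‖D_a f‖ ≤ c a^(-1/p) ‖f‖}`. -/
def lowerBoydOf (N : (ℝ → ℝ) → ℝ≥0∞) : ℝ≥0∞ :=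
  ⨆ p ∈ {p : ℝ | 0 < p ∧ ∃ c : ℝ, 0 < c ∧ ∀ a : ℝ, 0 < a → a < 1 →
      ∀ f : ℝ → ℝ, AEMeasurable f volume → N f < ∞ →
        N (dil a f) ≤ ENNReal.ofReal (c * a ^ (-(1/p))) * N f},
    ENNReal.ofReal p

/-- The upper Boyd index of a quasi-norm functional:
`inf {q > 0 : ∃ c > 0, ∀ a > 1, ∀ f ∈ X, ‖D_a f‖ ≤ c a^(-1/q) ‖f‖}`. -/
def upperBoydOf (N : (ℝ → ℝ) → ℝ≥0∞) : ℝ≥0∞ :=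
  ⨅ q ∈ {q : ℝ | 0 < q ∧ ∃ c : ℝ, 0 < c ∧ ∀ a : ℝ, 1 < a →
      ∀ f : ℝ → ℝ, AEMeasurable f volume → N f < ∞ →
        N (dil a f) ≤ ENNReal.ofReal (c * a ^ (-(1/q))) * N f},
    ENNReal.ofReal q

/-- The lower Boyd index `p_X`. -/
def lowerBoyd (X : RIQB) : ℝ≥0∞ := lowerBoydOf X.Nr

/-- The upper Boyd index `q_X`. -/
def upperBoyd (X : RIQB) : ℝ≥0∞ := upperBoydOf X.Nr

/-- The Hardy operator `H^{(p,r)}` acting on a nonnegative (`ℝ≥0∞`-valued) function: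
`t^{-1/p} ((r/p) ∫₀ᵗ g(s)^r s^{r/p-1} ds)^{1/r}` for `t > 0`, and `0` for `t ≤ 0`. -/
def hardyUE (p r : ℝ) (g : ℝ → ℝ≥0∞) : ℝ → ℝ≥0∞ := fun t =>
  if 0 < t then
    ENNReal.ofReal t ^ (-(1/p)) *
      (ENNReal.ofReal (r/p) *
        ∫⁻ s in Ioo (0:ℝ) t, g s ^ r * ENNReal.ofReal (s ^ (r/p - 1))) ^ (1/r)
  else 0

/-- The Hardy operator `H^{(p,r)} f (t) = t^{-1/p} ((r/p) ∫₀ᵗ f^*(s)^r s^{r/p-1} ds)^{1/r}`. -/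
def hardyU (p r : ℝ) (f : ℝ → ℝ) : ℝ → ℝ≥0∞ := hardyUE p r (rearr f)

/-- The Hardy operator `H^{(p,∞)} f (t) = sup_{0<s<t} (s/t)^{1/p} f^*(s)`. -/
def hardyUSup (p : ℝ) (f : ℝ → ℝ) : ℝ → ℝ≥0∞ := fun t =>
  if 0 < t then ⨆ s ∈ Ioo (0:ℝ) t, ENNReal.ofReal ((s/t) ^ (1/p)) * rearr f s else 0

/-- The Hardy operator
`H_{(q,r)} f (t) = t^{-1/q} ((r/q) ∫_t^∞ f^*(s)^r s^{r/q-1} ds)^{1/r}` for finite `q`. -/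
def hardyL (q r : ℝ) (f : ℝ → ℝ) : ℝ → ℝ≥0∞ := fun t =>
  if 0 < t then
    ENNReal.ofReal t ^ (-(1/q)) *
      (ENNReal.ofReal (r/q) *
        ∫⁻ s in Ioi t, rearr f s ^ r * ENNReal.ofReal (s ^ (r/q - 1))) ^ (1/r)
  else 0

/-- The Hardy operator `H_{(∞,r)} f (t) = (∫_t^∞ f^*(s)^r s⁻¹ ds)^{1/r}`. -/
def hardyLInf (r : ℝ) (f : ℝ → ℝ) : ℝ → ℝ≥0∞ := fun t =>
  if 0 < t then (∫⁻ s in Ioi t, rearr f s ^ r * ENNReal.ofReal s⁻¹) ^ (1/r) else 0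

/-- The Hardy operator `H_{(q,r)}` for `0 < q ≤ ∞`, `0 < r < ∞`. -/
def hardyLG (q : ℝ≥0∞) (r : ℝ) (f : ℝ → ℝ) : ℝ → ℝ≥0∞ :=
  if q = ∞ then hardyLInf r f else hardyL q.toReal r f

/-- The Hardy operator `H_{(q,∞)} f (t) = sup_{s>t} (s/t)^{1/q} f^*(s)`. -/
def hardyLSup (q : ℝ) (f : ℝ → ℝ) : ℝ → ℝ≥0∞ := fun t =>
  if 0 < t then ⨆ s ∈ Ioi t, ENNReal.ofReal ((s/t) ^ (1/q)) * rearr f s else 0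

/-- The Hardy operator `H^{(p,r)}` for `0 < p < ∞`, `0 < r ≤ ∞`. -/
def hardyUG (p : ℝ) (r : ℝ≥0∞) (f : ℝ → ℝ) : ℝ → ℝ≥0∞ :=
  if r = ∞ then hardyUSup p f else hardyU p r.toReal f

/-- The Hardy operator `H_{(q,s)}` for `0 < q ≤ ∞`, `0 < s ≤ ∞`
(with `H_{(∞,∞)} f = f^*`). -/
def hardyLGG (q s : ℝ≥0∞) (f : ℝ → ℝ) : ℝ → ℝ≥0∞ :=
  if q = ∞ then
    (if s = ∞ then (fun t => if 0 < t then rearr f t else 0) else hardyLInf s.toReal f)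
  else
    (if s = ∞ then hardyLSup q.toReal f else hardyL q.toReal s.toReal f)

/-- The Lorentz quasi-norm `‖f‖_{p,r}` for `0 < p ≤ ∞`, `0 < r ≤ ∞`. -/
def lorentz (p r : ℝ≥0∞) (f : ℝ → ℝ) : ℝ≥0∞ :=
  if p = ∞ then
    (if r = ∞ then essSup (fun x => ENNReal.ofReal |f x|) volume
     else (∫⁻ t in Ioi (0:ℝ), rearr f t ^ r.toReal * ENNReal.ofReal t⁻¹) ^ (1/r.toReal))
  else
    (if r = ∞ then ⨆ t ∈ Ioi (0:ℝ), ENNReal.ofReal t ^ (1/p.toReal) * rearr f t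
     else (∫⁻ t in Ioi (0:ℝ),
        (ENNReal.ofReal t ^ (1/p.toReal) * rearr f t) ^ r.toReal * ENNReal.ofReal t⁻¹) ^
          (1/r.toReal))

/-- The weak-`L_p` (Lorentz `(p,∞)`) quasi-norm of an `ℝ≥0∞`-valued function on `ℝ`:
`sup_{t>0} t^{1/p} g^*(t)`. -/
def lorentzWE (p : ℝ) (g : ℝ → ℝ≥0∞) : ℝ≥0∞ :=
  ⨆ t ∈ Ioi (0:ℝ), ENNReal.ofReal t ^ (1/p) * rearrE g t

lemma distRearr_mono_ae {α : Type*} [MeasurableSpace α] {μ : Measure α} {g h : α → ℝ≥0∞}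
    (hgh : g ≤ᵐ[μ] h) (s : ℝ) : distRearr μ g s ≤ distRearr μ h s :=
  sSup_le_sSup fun _ ht => lt_of_lt_of_le ht
    (measure_mono_ae (hgh.mono fun _ hx hx' => lt_of_lt_of_le hx' hx))

lemma distRearr_antitone {α : Type*} [MeasurableSpace α] (μ : Measure α) (g : α → ℝ≥0∞) :
    Antitone (distRearr μ g) := fun _ _ hst =>
  sSup_le_sSup fun _ ht => lt_of_le_of_lt (ENNReal.ofReal_le_ofReal hst) ht

/-- The rearrangement of a function that is decreasing on `(0, ∞)` dominates every lower
bound of it that is continuous at the point of evaluation. -/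
lemma le_rearrE_of_antitoneOn {g L : ℝ → ℝ≥0∞} (hg : AntitoneOn g (Ioi 0)) {s : ℝ} (hs : 0 < s)
    (hL : ContinuousAt L s) (hLg : ∀ u, s < u → L u ≤ g u) : L s ≤ rearrE g s := by
  have hlim : Tendsto L (𝓝[>] s) (𝓝 (L s)) := hL.tendsto.mono_left nhdsWithin_le_nhds
  refine le_of_tendsto hlim ?_
  filter_upwards [self_mem_nhdsWithin] with u hu
  refine le_of_forall_lt fun t ht => ?_
  obtain ⟨t', htt', ht'⟩ := exists_between ht
  refine htt'.trans_le (le_sSup ?_)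
  calc ENNReal.ofReal s < ENNReal.ofReal u := (ENNReal.ofReal_lt_ofReal_iff (hs.trans hu)).2 hu
    _ = volume (Ioc 0 u) := by simp
    _ ≤ volume {x | t' < g x} := measure_mono fun x hx =>
        (ht'.trans_le (hLg u hu)).trans_le (hg hx.1 (hs.trans hu) hx.2)

lemma rearr_dil {a : ℝ} (ha : 0 < a) (f : ℝ → ℝ) (s : ℝ) :
    rearr (dil a f) s = rearr f (a * s) := by
  unfold rearr rearrE distRearr
  congr 1
  ext t
  have h := Real.volume_preimage_mul_left ha.ne' {x | t < ENNReal.ofReal |f x|}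
  rw [abs_of_pos (inv_pos.2 ha), ENNReal.ofReal_inv_of_pos ha] at h
  change ENNReal.ofReal s < volume ((a * ·) ⁻¹' {x | t < ENNReal.ofReal |f x|}) ↔ _
  rw [h, mem_ofPred_eq, ENNReal.ofReal_mul ha.le, mul_comm _ (volume _), ← div_eq_mul_inv,
    ENNReal.lt_div_iff_mul_lt (by simp) (by simp), mul_comm]

lemma aemeasurable_dil {a : ℝ} (ha : a ≠ 0) {f : ℝ → ℝ} (hf : AEMeasurable f volume) :
    AEMeasurable (dil a f) volume := by
  refine hf.comp_quasiMeasurePreserving (f := fun t => a * t) ⟨by fun_prop, ?_⟩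
  rw [Real.map_volume_mul_left ha]
  exact Measure.smul_absolutelyContinuous

lemma RIQB.mono_ae (X : RIQB) {g h : ℝ → ℝ≥0∞} (hg : AEMeasurable g volume)
    (hh : AEMeasurable h volume) (hgh : h ≤ᵐ[volume] g) : X.N h ≤ X.N g :=
  X.rearr_mono g h hg hh fun s _ => distRearr_mono_ae hgh s

lemma RIQB.ae_ne_top (X : RIQB) {g : ℝ → ℝ≥0∞} (hg : AEMeasurable g volume) (hN : X.N g < ∞) :
    ∀ᵐ x, g x ≠ ∞ := by
  have hφ : Measurable fun y : ℝ≥0∞ => if y = ∞ then (1 : ℝ≥0∞) else 0 :=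
    Measurable.ite (measurableSet_singleton _) measurable_const measurable_const
  have hm := hφ.comp_aemeasurable hg
  have hle : ∞ * X.N ((fun y : ℝ≥0∞ => if y = ∞ then (1 : ℝ≥0∞) else 0) ∘ g) ≤ X.N g := by
    rw [← X.norm_smul]
    refine X.mono_ae hg (hm.const_mul _) (Eventually.of_forall fun x => ?_)
    by_cases hx : g x = ∞ <;> simp [hx]
  have h0 : X.N ((fun y : ℝ≥0∞ => if y = ∞ then (1 : ℝ≥0∞) else 0) ∘ g) = 0 := by
    by_contra h
    rw [ENNReal.top_mul h] at hle
    exact absurd hN (not_lt.2 hle)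
  filter_upwards [(X.definite _ hm).1 h0] with x hx hx'
  simp [hx'] at hx

lemma measurable_hardyUE (p r : ℝ) (g : ℝ → ℝ≥0∞) : Measurable (hardyUE p r g) := by
  have hmono : Monotone fun t : ℝ =>
      ∫⁻ s in Ioo (0:ℝ) t, g s ^ r * ENNReal.ofReal (s ^ (r/p - 1)) := fun _ _ h =>
    lintegral_mono_set (Ioo_subset_Ioo_right h)
  have := hmono.measurable
  exact Measurable.ite measurableSet_Ioi (by fun_prop) measurable_const

lemma antitoneOn_hardyUE {p r : ℝ} (hp : 0 < p) (hr : 0 < r) {g : ℝ → ℝ≥0∞} (hg : Antitone g) :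
    AntitoneOn (hardyUE p r g) (Ioi 0) := by
  intro t ht u hu htu
  rw [mem_Ioi] at ht hu
  set c := u / t with hc
  have hc0 : 0 < c := div_pos hu ht
  have hc1 : 1 ≤ c := (one_le_div ht).2 htu
  have himg : (fun x => c * x) '' Ioo 0 t = Ioo 0 u := by
    rw [Set.image_mul_left_Ioo hc0, mul_zero, hc, div_mul_cancel₀ _ ht.ne']
  have hint : ∫⁻ s in Ioo (0:ℝ) u, g s ^ r * ENNReal.ofReal (s ^ (r/p - 1)) ≤
      ENNReal.ofReal (c ^ (r/p)) *
        ∫⁻ s in Ioo (0:ℝ) t, g s ^ r * ENNReal.ofReal (s ^ (r/p - 1)) := by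
    rw [← himg, lintegral_image_eq_lintegral_abs_deriv_mul (f' := fun _ => c) measurableSet_Ioo
      (fun x _ => by simpa using ((hasDerivAt_id x).const_mul c).hasDerivWithinAt)
      (mul_right_injective₀ hc0.ne').injOn, ← lintegral_const_mul' _ _ ENNReal.ofReal_ne_top]
    refine setLIntegral_mono' measurableSet_Ioo fun x hx => ?_
    have hcx : ENNReal.ofReal |c| * ENNReal.ofReal ((c * x) ^ (r/p - 1)) =
        ENNReal.ofReal (c ^ (r/p)) * ENNReal.ofReal (x ^ (r/p - 1)) := by
      rw [← ENNReal.ofReal_mul (abs_nonneg _), ← ENNReal.ofReal_mul (by positivity),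
        abs_of_pos hc0, Real.mul_rpow hc0.le hx.1.le, Real.rpow_sub_one hc0.ne']
      congr 1
      field_simp
    calc ENNReal.ofReal |c| * (g (c * x) ^ r * ENNReal.ofReal ((c * x) ^ (r/p - 1)))
        = g (c * x) ^ r * (ENNReal.ofReal |c| * ENNReal.ofReal ((c * x) ^ (r/p - 1))) := by ring
      _ ≤ g x ^ r * (ENNReal.ofReal |c| * ENNReal.ofReal ((c * x) ^ (r/p - 1))) := by
          gcongr
          exact hg (by nlinarith [hx.1])
      _ = _ := by rw [hcx]; ring
  unfold hardyUE
  rw [if_pos ht, if_pos hu]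
  refine (mul_le_mul_right (ENNReal.rpow_le_rpow (mul_le_mul_right hint _) (by positivity)) _).trans
    (le_of_eq ?_)
  rw [mul_left_comm, ENNReal.mul_rpow_of_nonneg _ _ (by positivity : (0:ℝ) ≤ 1/r), ← mul_assoc]
  congr 1
  rw [ENNReal.ofReal_rpow_of_nonneg (x := c ^ (r/p)) (by positivity) (by positivity), ← Real.rpow_mul hc0.le,
    ENNReal.ofReal_rpow_of_pos hu, ENNReal.ofReal_rpow_of_pos ht,
    ← ENNReal.ofReal_mul (by positivity), hc,
    show r / p * (1 / r) = 1 / p by field_simp, Real.div_rpow hu.le ht.le, Real.rpow_neg hu.le,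
    Real.rpow_neg ht.le]
  congr 1
  have := (Real.rpow_pos_of_pos hu (1/p)).ne'
  field_simp

/-- A pointwise lower bound on `(c, d)` passes to the Hardy operator, the integral being
computed through a primitive `G`. -/
lemma le_hardyUE_of_hasDerivAt {p r c d t : ℝ} (hp : 0 < p) (hr : 0 < r) (hc : 0 ≤ c)
    (hcd : c ≤ d) (hdt : d ≤ t) (ht : 0 < t) {g : ℝ → ℝ≥0∞} {ψ G : ℝ → ℝ}
    (hψ : ∀ s ∈ Ioo c d, 0 ≤ ψ s) (hg : ∀ s ∈ Ioo c d, ENNReal.ofReal (ψ s ^ (1/r)) ≤ g s)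
    (hGc : ContinuousOn G (Icc c d))
    (hG : ∀ s ∈ Ioo c d, HasDerivAt G (r/p * (ψ s * s ^ (r/p - 1))) s) :
    ENNReal.ofReal ((t ^ (-(r/p)) * (G d - G c)) ^ (1/r)) ≤ hardyUE p r g t := by
  have hnn : ∀ s ∈ Ioo c d, 0 ≤ r/p * (ψ s * s ^ (r/p - 1)) := fun s hs => by
    have := hψ s hs
    have : 0 < s := hc.trans_lt hs.1
    positivity
  have hint := intervalIntegral.integrableOn_deriv_of_nonneg hGc hG hnn
  have hFTC := intervalIntegral.integral_eq_sub_of_hasDerivAt_of_le hcd hGc hG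
    ((intervalIntegrable_iff_integrableOn_Ioc_of_le hcd).2 hint)
  have hG0 : 0 ≤ G d - G c := by
    rw [← hFTC, intervalIntegral.integral_of_le hcd, integral_Ioc_eq_integral_Ioo]
    exact setIntegral_nonneg measurableSet_Ioo hnn
  have hle : ENNReal.ofReal (G d - G c) ≤ ENNReal.ofReal (r/p) *
        ∫⁻ s in Ioo (0:ℝ) t, g s ^ r * ENNReal.ofReal (s ^ (r/p - 1)) := by
    rw [← hFTC, intervalIntegral.integral_of_le hcd, integral_Ioc_eq_integral_Ioo,
      ofReal_integral_eq_lintegral_ofReal (hint.mono_set Ioo_subset_Ioc_self)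
        ((ae_restrict_iff' measurableSet_Ioo).2 (Eventually.of_forall hnn)),
      ← lintegral_const_mul' _ _ ENNReal.ofReal_ne_top]
    refine (setLIntegral_mono' measurableSet_Ioo fun s hs => ?_).trans
      (lintegral_mono_set (Ioo_subset_Ioo hc hdt))
    rw [ENNReal.ofReal_mul (by positivity), ENNReal.ofReal_mul (hψ s hs)]
    gcongr
    calc ENNReal.ofReal (ψ s) = ENNReal.ofReal (ψ s ^ (1/r)) ^ r := by
          rw [ENNReal.ofReal_rpow_of_nonneg (Real.rpow_nonneg (hψ s hs) _) hr.le,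
            ← Real.rpow_mul (hψ s hs), one_div_mul_cancel hr.ne', Real.rpow_one]
      _ ≤ g s ^ r := ENNReal.rpow_le_rpow (hg s hs) hr.le
  unfold hardyUE
  rw [if_pos ht, Real.mul_rpow (by positivity) hG0, ENNReal.ofReal_mul (by positivity),
    ← Real.rpow_mul ht.le, show -(r/p) * (1/r) = -(1/p) by field_simp,
    ENNReal.ofReal_rpow_of_pos ht]
  gcongr
  rw [← ENNReal.ofReal_rpow_of_nonneg hG0 (by positivity)]
  exact ENNReal.rpow_le_rpow hle (by positivity)

/-- The `r`-th power of the value at `t ≥ b` of `k + 1` iterations of the Hardy operator on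
`B ^ (1/r)` times the indicator of `(0, b)`, where `α = r/p`. -/
def hardyProfile (α b B : ℝ) (k : ℕ) (t : ℝ) : ℝ :=
  B * (b ^ α * t ^ (-α)) * ((α * (Real.log t - Real.log b)) ^ k / (k.factorial : ℝ))

lemma hardyProfile_nonneg {α b B t : ℝ} (hα : 0 < α) (hb : 0 < b) (hB : 0 ≤ B) (ht : b ≤ t)
    (k : ℕ) : 0 ≤ hardyProfile α b B k t := by
  have := sub_nonneg.2 (Real.log_le_log hb ht)
  have := hb.trans_le ht
  unfold hardyProfile
  positivity

lemma continuousAt_hardyProfile {α b B t : ℝ} (ht : 0 < t) (k : ℕ) :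
    ContinuousAt (hardyProfile α b B k) t := by
  have h1 := Real.continuousAt_rpow_const t (-α) (Or.inl ht.ne')
  have h2 := Real.continuousAt_log ht.ne'
  unfold hardyProfile
  fun_prop

/-- The iterates `f, H f, H (H f), …` of the Hardy operator, as real-valued functions. -/
def hardyIter (p r : ℝ) (f : ℝ → ℝ) : ℕ → ℝ → ℝ
  | 0 => f
  | k + 1 => fun t => (hardyU p r (hardyIter p r f k) t).toReal

lemma antitoneOn_hardyU {p r : ℝ} (hp : 0 < p) (hr : 0 < r) (f : ℝ → ℝ) :
    AntitoneOn (hardyU p r f) (Ioi 0) :=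
  antitoneOn_hardyUE hp hr (distRearr_antitone _ _)

lemma ofReal_hardyIter_succ_ae_eq {X : RIQB} {p r C : ℝ}
    (hbound : ∀ f : ℝ → ℝ, X.mem f → X.N (hardyU p r f) ≤ ENNReal.ofReal C * X.Nr f)
    {f : ℝ → ℝ} {k : ℕ} (hf : X.mem (hardyIter p r f k)) :
    (fun x => ENNReal.ofReal |hardyIter p r f (k + 1) x|) =ᵐ[volume]
      hardyU p r (hardyIter p r f k) := by
  filter_upwards [X.ae_ne_top (measurable_hardyUE p r _).aemeasurable
    ((hbound _ hf).trans_lt (ENNReal.mul_lt_top ENNReal.ofReal_lt_top hf.2))] with x hx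
  change ENNReal.ofReal |(hardyU p r (hardyIter p r f k) x).toReal| = _
  rw [abs_of_nonneg ENNReal.toReal_nonneg, ENNReal.ofReal_toReal (by exact hx)]

lemma hardyIter_mem {X : RIQB} {p r C : ℝ}
    (hbound : ∀ f : ℝ → ℝ, X.mem f → X.N (hardyU p r f) ≤ ENNReal.ofReal C * X.Nr f)
    {f : ℝ → ℝ} (hf : X.mem f) (k : ℕ) :
    X.mem (hardyIter p r f k) ∧ X.Nr (hardyIter p r f k) ≤ ENNReal.ofReal C ^ k * X.Nr f := by
  induction k with
  | zero => exact ⟨hf, by simp [hardyIter]⟩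
  | succ k ih =>
    have hH : Measurable (hardyU p r (hardyIter p r f k)) := measurable_hardyUE p r _
    have hm : Measurable (hardyIter p r f (k + 1)) := hH.ennreal_toReal
    have hle : X.Nr (hardyIter p r f (k + 1)) ≤ ENNReal.ofReal C ^ (k + 1) * X.Nr f :=
      calc X.Nr (hardyIter p r f (k + 1)) ≤ X.N (hardyU p r (hardyIter p r f k)) :=
            X.mono_ae hH.aemeasurable (by fun_prop)
              (ofReal_hardyIter_succ_ae_eq hbound ih.1).le
        _ ≤ ENNReal.ofReal C * (ENNReal.ofReal C ^ k * X.Nr f) :=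
            (hbound _ ih.1).trans (by gcongr; exact ih.2)
        _ = _ := by ring
    exact ⟨⟨hm.aemeasurable, hle.trans_lt
      (ENNReal.mul_lt_top (ENNReal.pow_lt_top ENNReal.ofReal_lt_top) hf.2)⟩, hle⟩

lemma hardyProfile_le_hardyU_hardyIter {X : RIQB} {p r C : ℝ} (hp : 0 < p) (hr : 0 < r)
    (hbound : ∀ f : ℝ → ℝ, X.mem f → X.N (hardyU p r f) ≤ ENNReal.ofReal C * X.Nr f)
    {f : ℝ → ℝ} (hf : X.mem f) {b B : ℝ} (hb : 0 < b) (hB : 0 ≤ B)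
    (hfB : ∀ s ∈ Ioo 0 b, ENNReal.ofReal (B ^ (1/r)) ≤ rearr f s) (k : ℕ) {t : ℝ} (ht : b ≤ t) :
    ENNReal.ofReal (hardyProfile (r/p) b B k t ^ (1/r)) ≤
      hardyU p r (hardyIter p r f k) t := by
  have hα : 0 < r/p := div_pos hr hp
  induction k generalizing t with
  | zero =>
    have h := le_hardyUE_of_hasDerivAt (G := fun s => B * s ^ (r/p)) (ψ := fun _ => B)
      (g := rearr f) hp hr le_rfl hb.le ht (hb.trans_le ht) (fun _ _ => hB) hfB
      (Continuous.continuousOn (by fun_prop (disch := positivity)))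
      (fun s hs => ((Real.hasDerivAt_rpow_const (p := r/p)
        (Or.inl hs.1.ne')).const_mul B).congr_deriv (by ring))
    refine (ENNReal.ofReal_le_ofReal (le_of_eq ?_)).trans h
    congr 1
    simp only [hardyProfile, Real.zero_rpow hα.ne', pow_zero, Nat.factorial_zero, Nat.cast_one]
    ring
  | succ k ih =>
    have hlow : ∀ s ∈ Ioo b t, ENNReal.ofReal (hardyProfile (r/p) b B k s ^ (1/r)) ≤
        rearr (hardyIter p r f (k + 1)) s := fun s hs => by
      have hs0 := hb.trans hs.1
      refine (le_rearrE_of_antitoneOn (antitoneOn_hardyU hp hr _) hs0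
        (L := fun u => ENNReal.ofReal (hardyProfile (r/p) b B k u ^ (1/r))) ?_
        fun u hu => ih (hs.1.trans hu).le).trans
        (distRearr_mono_ae (ofReal_hardyIter_succ_ae_eq hbound
          (hardyIter_mem hbound hf k).1).symm.le s)
      exact ENNReal.continuous_ofReal.continuousAt.comp
        ((continuousAt_hardyProfile hs0 k).rpow_const (Or.inr (by positivity)))
    have hder : ∀ s, 0 < s → HasDerivAt (fun s => B * b ^ (r/p) *
        ((r/p * (Real.log s - Real.log b)) ^ (k + 1) / ((k + 1).factorial : ℝ)))
        (r/p * (hardyProfile (r/p) b B k s * s ^ (r/p - 1))) s := fun s hs => by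
      refine ((((((Real.hasDerivAt_log hs.ne').sub_const (Real.log b)).const_mul (r/p)).pow
        (k + 1)).div_const ((k + 1).factorial : ℝ)).const_mul (B * b ^ (r/p))).congr_deriv ?_
      rw [hardyProfile, Real.rpow_sub_one hs.ne', Real.rpow_neg hs.le, Nat.factorial_succ]
      have := (Real.rpow_pos_of_pos hs (r/p)).ne'
      push_cast
      field_simp
    have h := le_hardyUE_of_hasDerivAt hp hr hb.le ht le_rfl (hb.trans_le ht)
      (fun s hs => hardyProfile_nonneg hα hb hB hs.1.le k) hlow
      (fun s hs => (hder s (hb.trans_le hs.1)).continuousAt.continuousWithinAt)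
      (fun s hs => hder s (hb.trans hs.1))
    refine (ENNReal.ofReal_le_ofReal (le_of_eq ?_)).trans h
    congr 1
    simp only [hardyProfile, sub_self, mul_zero, zero_pow k.succ_ne_zero]
    ring

/-- Dilation estimate from boundedness of the Hardy operator: if `‖H^{(p,r)} f‖ ≤ C ‖f‖`
on `X`, then `‖D_a f‖ ≤ C^{n+1} (n! / (a^{r/p} ((r/p) log(1/a))ⁿ))^{1/r} ‖f‖`. -/
theorem dil_bound_of_hardyU_bounded (X : RIQB) (p r C : ℝ) (hp : 0 < p) (hr : 0 < r)
    (hbound : ∀ f : ℝ → ℝ, X.mem f → X.N (hardyU p r f) ≤ ENNReal.ofReal C * X.Nr f)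
    (n : ℕ) (a : ℝ) (ha : 0 < a) (ha1 : a < 1) (f : ℝ → ℝ) (hf : X.mem f) :
    X.Nr (dil a f) ≤
      ENNReal.ofReal (C ^ (n + 1) *
        ((Nat.factorial n : ℝ) / (a ^ (r/p) * ((r/p) * Real.log (1/a)) ^ n)) ^ (1/r)) *
        X.Nr f := by
  have hlog : 0 < Real.log (1/a) := Real.log_pos ((one_lt_div ha).2 ha1)
  set K := ((Nat.factorial n : ℝ) / (a ^ (r/p) * ((r/p) * Real.log (1/a)) ^ n)) ^ (1/r) with hK
  have hK0 : 0 ≤ K := by positivity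
  set H := hardyU p r (hardyIter p r f n)
  have hH : Measurable H := measurable_hardyUE p r _
  obtain ⟨hmem, hnorm⟩ := hardyIter_mem hbound hf n
  have hdil : X.Nr (dil a f) ≤ X.N fun x => ENNReal.ofReal K * H x := by
    refine X.rearr_mono _ _ (by fun_prop)
      (aemeasurable_dil ha.ne' hf.1).abs.ennreal_ofReal fun s hs => ?_
    change rearr (dil a f) s ≤ _
    rw [rearr_dil ha]
    refine ENNReal.le_of_forall_nnreal_lt fun A hA => ?_
    set B : ℝ := (A : ℝ) ^ r
    have hBA : B ^ (1/r) = A := by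
      simp only [B]
      rw [← Real.rpow_mul A.coe_nonneg, mul_one_div_cancel hr.ne', Real.rpow_one]
    have hb : 0 < a * s := mul_pos ha hs
    have hbs : a * s ≤ s := by nlinarith
    have hlow : ∀ u, a * s ≤ u →
        ENNReal.ofReal (hardyProfile (r/p) (a * s) B n u ^ (1/r)) ≤ H u := fun u hu =>
      hardyProfile_le_hardyU_hardyIter hp hr hbound hf hb (by positivity)
        (fun v hv => by
          rw [hBA, ENNReal.ofReal_coe_nnreal]
          exact hA.le.trans (distRearr_antitone _ _ hv.2.le)) n hu
    have hval : (A : ℝ≥0∞) =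
        ENNReal.ofReal K * ENNReal.ofReal (hardyProfile (r/p) (a * s) B n s ^ (1/r)) := by
      rw [← ENNReal.ofReal_mul hK0, hK, ← Real.mul_rpow (by positivity)
        (hardyProfile_nonneg (by positivity) hb (by positivity) hbs n)]
      suffices h : (n.factorial : ℝ) / (a ^ (r/p) * ((r/p) * Real.log (1/a)) ^ n) *
          hardyProfile (r/p) (a * s) B n s = B by
        rw [h, hBA, ENNReal.ofReal_coe_nnreal]
      rw [hardyProfile, Real.log_mul ha.ne' hs.ne', Real.mul_rpow ha.le hs.le,
        Real.rpow_neg hs.le, show Real.log s - (Real.log a + Real.log s) = Real.log (1/a) by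
          rw [one_div, Real.log_inv]; ring]
      field_simp
    rw [hval]
    refine le_rearrE_of_antitoneOn (g := fun x => ENNReal.ofReal K * H x)
      (L := fun u => ENNReal.ofReal K *
        ENNReal.ofReal (hardyProfile (r/p) (a * s) B n u ^ (1/r)))
      (fun u hu v hv huv => mul_le_mul_right (antitoneOn_hardyU hp hr _ hu hv huv) _) hs ?_
      fun u hu => mul_le_mul_right (hlow u (hbs.trans hu.le)) _
    exact (ENNReal.continuous_const_mul ENNReal.ofReal_ne_top).continuousAt.comp
      (ENNReal.continuous_ofReal.continuousAt.comp
        ((continuousAt_hardyProfile hs n).rpow_const (Or.inr (by positivity))))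
  calc X.Nr (dil a f) ≤ ENNReal.ofReal K * X.N H := hdil.trans_eq (X.norm_smul _ _)
    _ ≤ ENNReal.ofReal K * (ENNReal.ofReal C * (ENNReal.ofReal C ^ n * X.Nr f)) := by
        gcongr
        exact (hbound _ hmem).trans (by gcongr)
    _ = ENNReal.ofReal C ^ (n + 1) * ENNReal.ofReal K * X.Nr f := by ring
    _ ≤ ENNReal.ofReal (C ^ (n + 1) * K) * X.Nr f := by
        rcases le_or_gt C 0 with hC | hC
        · simp [ENNReal.ofReal_of_nonpos hC]
        · rw [ENNReal.ofReal_mul (by positivity), ENNReal.ofReal_pow hC.le]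

end
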